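/- arXiv:2308.07115 — 2 statements merged into one kernel-verified Lean document; each statement's English description precedes it below -/
import Mathlib

section
/- Let μ>0 and 0 < δ₁ < μ. Then there exist δ₂ > 0 and constants C > 0, T₀ ∈ (0,μ) such that for all 0 < T < T₀, sup over q, q' ∈ ℝ² with |q| < δ₂ and |q'| < δ₂ of the integral ∫_{ℝ³} (1 − χ_{μ−δ₁<p₂²<μ+δ₁} χ_{p₁²<4δ₁} χ_{p₁'²<4δ₁}) B_T((p₁,p₂),q) · B_T((p₁',p₂),q') dp₁ dp₁' dp₂ is at most C · (log(μ/T))^{5/2}, where χ denotes the indicator function of the indicated condition. -/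
open MeasureTheory Real

/-- The function `B_T(p,q)` on `ℝ² × ℝ²`, set to `0` on the measure-zero set
`|p|² + |q|² = μ` where the defining expression is singular. -/
noncomputable def BT (T μ : ℝ) (p q : ℝ × ℝ) : ℝ :=
  if p.1 ^ 2 + p.2 ^ 2 + q.1 ^ 2 + q.2 ^ 2 = μ then 0
  else
    (Real.tanh (((p.1 + q.1) ^ 2 + (p.2 + q.2) ^ 2 - μ) / (2 * T)) +
        Real.tanh (((p.1 - q.1) ^ 2 + (p.2 - q.2) ^ 2 - μ) / (2 * T))) /
      (2 * (p.1 ^ 2 + p.2 ^ 2 + q.1 ^ 2 + q.2 ^ 2 - μ))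

theorem hasDerivAt_real_tanh (x : ℝ) : HasDerivAt Real.tanh (1 / Real.cosh x ^ 2) x := by
  have h := (Real.hasDerivAt_sinh x).div (Real.hasDerivAt_cosh x) (Real.cosh_pos x).ne'
  have e : Real.tanh = Real.sinh / Real.cosh := funext Real.tanh_eq_sinh_div_cosh
  rw [e]
  have hn : Real.cosh x * Real.cosh x - Real.sinh x * Real.sinh x = 1 := by
    rw [← Real.cosh_sq_sub_sinh_sq x]; ring
  rwa [hn] at h

theorem continuous_real_tanh : Continuous Real.tanh :=
  continuous_iff_continuousAt.2 fun x => (hasDerivAt_real_tanh x).continuousAt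

theorem monotone_real_tanh : Monotone Real.tanh :=
  monotone_of_hasDerivAt_nonneg hasDerivAt_real_tanh fun x => by positivity

theorem monotone_sub_real_tanh : Monotone fun x => x - Real.tanh x := by
  refine monotone_of_hasDerivAt_nonneg (fun x => (hasDerivAt_id x).sub (hasDerivAt_real_tanh x))
    fun x => ?_
  have h : 1 / Real.cosh x ^ 2 ≤ 1 := by
    rw [div_le_one (by positivity)]
    nlinarith [Real.one_le_cosh x]
  simpa using h

theorem tanh_add_tanh_mem_Icc {x y : ℝ} (h : 0 ≤ x + y) :
    0 ≤ Real.tanh x + Real.tanh y ∧ Real.tanh x + Real.tanh y ≤ x + y := by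
  have hxy : -y ≤ x := by linarith
  have h1 := monotone_real_tanh hxy
  have h2 := monotone_sub_real_tanh hxy
  simp only [Real.tanh_neg] at h1 h2
  constructor <;> linarith

/-- The quotient `B_T` is comparable to `1 / (T + ||p|² + |q|² - μ|)`. -/
theorem BT_mem_Icc {T : ℝ} (μ : ℝ) (hT : 0 < T) (p q : ℝ × ℝ) :
    0 ≤ BT T μ p q ∧
      BT T μ p q ≤ 2 / (T + |p.1 ^ 2 + p.2 ^ 2 + q.1 ^ 2 + q.2 ^ 2 - μ|) := by
  unfold BT
  split_ifs with h0
  · exact ⟨le_rfl, by positivity⟩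
  set D := p.1 ^ 2 + p.2 ^ 2 + q.1 ^ 2 + q.2 ^ 2 - μ with hD
  set X := ((p.1 + q.1) ^ 2 + (p.2 + q.2) ^ 2 - μ) / (2 * T) with hX
  set Y := ((p.1 - q.1) ^ 2 + (p.2 - q.2) ^ 2 - μ) / (2 * T) with hY
  have hXY : T * (X + Y) = D := by
    rw [hX, hY, hD]; field_simp; ring
  have hX1 := Real.tanh_lt_one X
  have hX2 := Real.neg_one_lt_tanh X
  have hY1 := Real.tanh_lt_one Y
  have hY2 := Real.neg_one_lt_tanh Y
  rcases lt_or_gt_of_ne (show D ≠ 0 from sub_ne_zero.2 h0) with hneg | hpos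
  · have hS : X + Y ≤ 0 := by
      by_contra! hc
      nlinarith [mul_pos hT hc]
    obtain ⟨h1, h2⟩ := tanh_add_tanh_mem_Icc (x := -X) (y := -Y) (by linarith)
    rw [Real.tanh_neg, Real.tanh_neg] at h1 h2
    refine ⟨div_nonneg_of_nonpos (by linarith) (by linarith), ?_⟩
    rw [abs_of_neg hneg, ← neg_div_neg_eq, div_le_div_iff₀ (by linarith) (by linarith)]
    nlinarith
  · have hS : 0 ≤ X + Y := by
      by_contra! hc
      nlinarith
    obtain ⟨h1, h2⟩ := tanh_add_tanh_mem_Icc hS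
    refine ⟨div_nonneg (by linarith) (by linarith), ?_⟩
    rw [abs_of_pos hpos, div_le_div_iff₀ (by linarith) (by linarith)]
    nlinarith

theorem measurable_BT (T μ : ℝ) (q : ℝ × ℝ) : Measurable fun p => BT T μ p q := by
  have := continuous_real_tanh.measurable
  unfold BT
  refine Measurable.ite (measurableSet_eq_fun (by fun_prop) (by fun_prop)) measurable_const ?_
  fun_prop

/-- Majorant of the one-dimensional profile of `B_T` near a zero of its denominator. -/
noncomputable def logKernel (T u : ℝ) : ℝ := 1 / ((T + |u|) * (1 + |u|))

theorem logKernel_nonneg {T : ℝ} (hT : 0 < T) (u : ℝ) : 0 ≤ logKernel T u := by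
  unfold logKernel; positivity

theorem continuous_logKernel {T : ℝ} (hT : 0 < T) : Continuous (logKernel T) := by
  unfold logKernel
  refine continuous_const.div (by fun_prop) fun u => ?_
  positivity

theorem integrable_logKernel {T : ℝ} (hT : 0 < T) (hT1 : T ≤ 1) : Integrable (logKernel T) := by
  refine (integrable_inv_one_add_sq.const_mul T⁻¹).mono'
    (continuous_logKernel hT).aestronglyMeasurable (.of_forall fun u => ?_)
  rw [Real.norm_of_nonneg (logKernel_nonneg hT u), logKernel, ← mul_inv, ← one_div]
  refine one_div_le_one_div_of_le (by positivity) ?_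
  rw [← sq_abs u]
  have := abs_nonneg u
  nlinarith [mul_nonneg hT.le this, mul_nonneg this this,
    mul_nonneg (sub_nonneg.2 hT1) (mul_nonneg this this)]

theorem integral_logKernel {T : ℝ} (hT : 0 < T) (hT1 : T < 1) :
    ∫ u, logKernel T u = 2 * (Real.log (1 / T) / (1 - T)) := by
  have hc := integral_comp_abs (f := fun u => 1 / ((T + u) * (1 + u)))
  have hint : ∫ u in Set.Ioi (0 : ℝ), 1 / ((T + u) * (1 + u)) =
      0 - (Real.log (T + 0) - Real.log (1 + 0)) / (1 - T) := by
    refine integral_Ioi_of_hasDerivAt_of_nonneg'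
      (g := fun u => (Real.log (T + u) - Real.log (1 + u)) / (1 - T)) ?_ ?_ ?_
    · intro u hu
      have hu : 0 ≤ u := hu
      have h1 : HasDerivAt (fun u => Real.log (T + u)) (1 / (T + u)) u :=
        ((hasDerivAt_id u).const_add T).log (by simp; positivity)
      have h2 : HasDerivAt (fun u => Real.log (1 + u)) (1 / (1 + u)) u :=
        ((hasDerivAt_id u).const_add 1).log (by simp; positivity)
      have h3 : 1 - T ≠ 0 := by linarith
      have h4 : T + u ≠ 0 := by positivity
      have h5 : 1 + u ≠ 0 := by positivity
      have he : (1 / (T + u) - 1 / (1 + u)) / (1 - T) = 1 / ((T + u) * (1 + u)) := by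
        field_simp
        ring
      exact he ▸ (h1.sub h2).div_const (1 - T)
    · intro u hu
      have hu : 0 < u := hu
      positivity
    · have hlim : Filter.Tendsto (fun u : ℝ => (T + u) / (1 + u)) Filter.atTop (nhds 1) := by
        have h : Filter.Tendsto (fun u : ℝ => 1 - (1 - T) / (1 + u)) Filter.atTop
            (nhds (1 - 0)) :=
          tendsto_const_nhds.sub (tendsto_const_nhds.div_atTop
            (Filter.tendsto_atTop_add_const_left _ 1 Filter.tendsto_id))
        rw [sub_zero] at h
        refine h.congr' ?_
        filter_upwards [Filter.eventually_gt_atTop 0] with u hu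
        have : 1 + u ≠ 0 := by positivity
        change 1 - (1 - T) / (1 + u) = (T + u) / (1 + u)
        field_simp
        ring
      have h := ((Real.continuousAt_log one_ne_zero).tendsto.comp hlim).div_const (1 - T)
      rw [Real.log_one, zero_div] at h
      refine h.congr' ?_
      filter_upwards [Filter.eventually_gt_atTop 0] with u hu
      simp only [Function.comp]
      rw [Real.log_div (by positivity) (by positivity)]
  rw [hint] at hc
  simp only [logKernel]
  rw [hc]
  simp only [add_zero, Real.log_one, one_div, Real.log_inv]
  ring

theorem lintegral_logKernel_le {T μ : ℝ} (hT : 0 < T) (hT2 : T ≤ 1 / 2) (hμ : 0 < μ)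
    (hTμ : T ≤ μ ^ 2) :
    ∫⁻ u, ENNReal.ofReal (logKernel T u) ≤ ENNReal.ofReal (8 * Real.log (μ / T)) := by
  rw [← ofReal_integral_eq_lintegral_ofReal (integrable_logKernel hT (by linarith))
    (.of_forall (logKernel_nonneg hT)), integral_logKernel hT (by linarith)]
  refine ENNReal.ofReal_le_ofReal ?_
  have h1 : Real.log (1 / T) ≤ 2 * Real.log (μ / T) := by
    have := Real.log_le_log hT hTμ
    rw [Real.log_pow] at this
    rw [Real.log_div hμ.ne' hT.ne', Real.log_div one_ne_zero hT.ne', Real.log_one]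
    push_cast at this
    linarith
  have h0 : 0 ≤ Real.log (1 / T) := Real.log_nonneg (by rw [le_div_iff₀ hT]; linarith)
  have h2 : Real.log (1 / T) / (1 - T) ≤ 2 * Real.log (1 / T) := by
    rw [div_le_iff₀ (by linarith)]
    nlinarith
  linarith

/-- Translates of `logKernel` at the two roots `±√a` of `x² = a`. -/
noncomputable def rootKernel (T a x : ℝ) : ℝ :=
  logKernel T (x - √a) + logKernel T (x + √a)

theorem lintegral_rootKernel_le {T μ : ℝ} (hT : 0 < T) (hT2 : T ≤ 1 / 2) (hμ : 0 < μ)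
    (hTμ : T ≤ μ ^ 2) (a : ℝ) :
    ∫⁻ x, ENNReal.ofReal (rootKernel T a x) ≤ ENNReal.ofReal (16 * Real.log (μ / T)) := by
  have h := lintegral_logKernel_le hT hT2 hμ hTμ
  have hm : Measurable fun x => ENNReal.ofReal (logKernel T (x - √a)) :=
    ((continuous_logKernel hT).comp (by fun_prop)).measurable.ennreal_ofReal
  have hsum : ∀ x, ENNReal.ofReal (rootKernel T a x) =
      ENNReal.ofReal (logKernel T (x - √a)) + ENNReal.ofReal (logKernel T (x + √a)) := fun x =>
    ENNReal.ofReal_add (logKernel_nonneg hT _) (logKernel_nonneg hT _)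
  simp_rw [hsum]
  rw [lintegral_add_left hm,
    lintegral_sub_right_eq_self (fun x => ENNReal.ofReal (logKernel T x)) (√a),
    lintegral_add_right_eq_self (fun x => ENNReal.ofReal (logKernel T x)) (√a)]
  rcases le_or_gt 0 (Real.log (μ / T)) with hL | hL
  · rw [show 16 * Real.log (μ / T) = 8 * Real.log (μ / T) + 8 * Real.log (μ / T) by ring,
      ENNReal.ofReal_add (by positivity) (by positivity)]
    exact add_le_add h h
  · rw [ENNReal.ofReal_of_nonpos (by linarith)] at h ⊢
    simpa using h

theorem one_div_le_rootKernel {T k a x : ℝ} (hT : 0 < T) (hT1 : T ≤ 1) (hk : 0 < k) (hk1 : k ≤ 1)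
    (h : k ^ 2 ≤ x ^ 2 ∨ k ^ 2 ≤ a) :
    1 / (T + |x ^ 2 - a|) ≤ 3 / k * rootKernel T a x := by
  set s := √a with hs
  have hs0 : 0 ≤ s := Real.sqrt_nonneg a
  set u := |x| - s with hu
  have hks : k ≤ |x| + s := by
    rcases h with h | h
    · have := Real.abs_le_sqrt h
      rw [Real.sqrt_sq_eq_abs, abs_of_pos hk] at this
      linarith
    · have := Real.le_sqrt_of_sq_le h
      linarith [abs_nonneg x]
  have hroot : logKernel T u ≤ rootKernel T a x := by
    unfold rootKernel
    rcases abs_cases x with ⟨hx, -⟩ | ⟨hx, -⟩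
    · rw [hu, hx]
      linarith [logKernel_nonneg hT (x + √a)]
    · have : logKernel T u = logKernel T (x + √a) := by
        unfold logKernel
        rw [hu, hx, ← abs_neg (x + √a), neg_add, sub_eq_add_neg]
      linarith [logKernel_nonneg hT (x - √a)]
  have hb : |u| * (|x| + s) ≤ |x ^ 2 - a| := by
    rw [← abs_of_nonneg (add_nonneg (abs_nonneg x) hs0), ← abs_mul]
    have he : u * (|x| + s) = x ^ 2 - s ^ 2 := by rw [hu, ← sq_abs x]; ring
    rw [he]
    rcases le_or_gt 0 a with ha | ha
    · rw [hs, Real.sq_sqrt ha]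
    · rw [hs, Real.sqrt_eq_zero_of_nonpos ha.le, abs_of_nonneg (by nlinarith : 0 ≤ x ^ 2 - a)]
      rw [abs_of_nonneg (by nlinarith [sq_nonneg x])]
      nlinarith
  have hux : |u| ≤ |x| + s := by
    rw [hu]
    exact abs_le.2 ⟨by linarith [abs_nonneg x], by linarith⟩
  have h0 := abs_nonneg u
  refine le_trans ?_ (mul_le_mul_of_nonneg_left hroot (by positivity))
  unfold logKernel
  have hb1 : |u| * k ≤ |x ^ 2 - a| := (mul_le_mul_of_nonneg_left hks h0).trans hb
  have hb2 : |u| * |u| ≤ |x ^ 2 - a| := (mul_le_mul_of_nonneg_left hux h0).trans hb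
  rw [div_mul_div_comm, div_le_div_iff₀ (by positivity) (by positivity)]
  have hB := abs_nonneg (x ^ 2 - a)
  nlinarith [mul_nonneg h0 hk.le, mul_le_mul_of_nonneg_left hT1 (mul_nonneg h0 hk.le),
    mul_le_mul_of_nonneg_left hk1 hT.le, mul_le_mul_of_nonneg_left hk1 (mul_nonneg h0 h0)]

theorem BT_le_rootKernel_fst {T μ k : ℝ} (hT : 0 < T) (hT1 : T ≤ 1) (hk : 0 < k) (hk1 : k ≤ 1)
    {x z : ℝ} {q : ℝ × ℝ} (h : k ^ 2 ≤ x ^ 2 ∨ k ^ 2 ≤ μ - q.1 ^ 2 - q.2 ^ 2 - z ^ 2) :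
    BT T μ (x, z) q ≤ 6 / k * rootKernel T (μ - q.1 ^ 2 - q.2 ^ 2 - z ^ 2) x := by
  refine (BT_mem_Icc μ hT (x, z) q).2.trans ?_
  have h1 := one_div_le_rootKernel hT hT1 hk hk1 h
  rw [show x ^ 2 + z ^ 2 + q.1 ^ 2 + q.2 ^ 2 - μ = x ^ 2 - (μ - q.1 ^ 2 - q.2 ^ 2 - z ^ 2) by ring,
    ← mul_one_div 2, show 6 / k = 2 * (3 / k) by ring, mul_assoc]
  linarith

theorem BT_le_rootKernel_snd {T μ k : ℝ} (hT : 0 < T) (hT1 : T ≤ 1) (hk : 0 < k) (hk1 : k ≤ 1)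
    {x z : ℝ} {q : ℝ × ℝ} (h : k ^ 2 ≤ z ^ 2 ∨ k ^ 2 ≤ μ - q.1 ^ 2 - q.2 ^ 2 - x ^ 2) :
    BT T μ (x, z) q ≤ 6 / k * rootKernel T (μ - q.1 ^ 2 - q.2 ^ 2 - x ^ 2) z := by
  refine (BT_mem_Icc μ hT (x, z) q).2.trans ?_
  have h1 := one_div_le_rootKernel hT hT1 hk hk1 h
  rw [show x ^ 2 + z ^ 2 + q.1 ^ 2 + q.2 ^ 2 - μ = z ^ 2 - (μ - q.1 ^ 2 - q.2 ^ 2 - x ^ 2) by ring,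
    ← mul_one_div 2, show 6 / k = 2 * (3 / k) by ring, mul_assoc]
  linarith

theorem BT_le_two_div {T μ m : ℝ} (hT : 0 < T) {p q : ℝ × ℝ} (hm : 0 < m)
    (h : m ≤ p.1 ^ 2 + p.2 ^ 2 - μ) : BT T μ p q ≤ 2 / m := by
  refine (BT_mem_Icc μ hT p q).2.trans (div_le_div_of_nonneg_left zero_le_two hm ?_)
  have := le_abs_self (p.1 ^ 2 + p.2 ^ 2 + q.1 ^ 2 + q.2 ^ 2 - μ)
  nlinarith [sq_nonneg q.1, sq_nonneg q.2]

theorem lintegral_mul_rootKernel_le {T μ K : ℝ} (hT : 0 < T) (hT2 : T ≤ 1 / 2) (hμ : 0 < μ)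
    (hTμ : T ≤ μ ^ 2) (hK : 0 ≤ K) (a : ℝ) :
    ∫⁻ x, ENNReal.ofReal (K * rootKernel T a x) ≤
      ENNReal.ofReal (16 * K * Real.log (μ / T)) := by
  simp_rw [ENNReal.ofReal_mul hK]
  rw [lintegral_const_mul' _ _ ENNReal.ofReal_ne_top,
    show 16 * K * Real.log (μ / T) = K * (16 * Real.log (μ / T)) by ring, ENNReal.ofReal_mul hK]
  gcongr
  exact lintegral_rootKernel_le hT hT2 hμ hTμ a

theorem lintegral_BT_slice_le {T μ δ k : ℝ} (hT : 0 < T) (hT2 : T ≤ 1 / 2) (hμ : 0 < μ)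
    (hTμ : T ≤ μ ^ 2) (hk : 0 < k) (hk1 : k ≤ 1) (hkδ : k ^ 2 ≤ δ / 4) {q : ℝ × ℝ}
    (hq : q.1 ^ 2 + q.2 ^ 2 < δ / 2) {z : ℝ} (hz : z ^ 2 ≤ μ - δ) :
    ∫⁻ x, ENNReal.ofReal (BT T μ (x, z) q) ≤
      ENNReal.ofReal (16 * (6 / k) * Real.log (μ / T)) := by
  refine le_trans (lintegral_mono fun x => ENNReal.ofReal_le_ofReal ?_)
    (lintegral_mul_rootKernel_le hT hT2 hμ hTμ (by positivity) (μ - q.1 ^ 2 - q.2 ^ 2 - z ^ 2))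
  exact BT_le_rootKernel_fst hT (by linarith) hk hk1 (.inr (by nlinarith [sq_nonneg k]))

theorem continuous_rootKernel {T : ℝ} (hT : 0 < T) :
    Continuous fun p : ℝ × ℝ => rootKernel T p.1 p.2 := by
  have := continuous_logKernel hT
  unfold rootKernel
  fun_prop

theorem lintegral_BT_strip_le {T μ δ k R : ℝ} (hT : 0 < T) (hT2 : T ≤ 1 / 2) (hμ : 0 < μ)
    (hTμ : T ≤ μ ^ 2) (hL : 0 ≤ Real.log (μ / T)) (hk : 0 < k) (hk1 : k ≤ 1) (hkδ : k ^ 2 ≤ δ / 4)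
    (hδ : δ < μ) (hR : 0 ≤ R) (hμR : μ ≤ R ^ 2) {q : ℝ × ℝ} (hq : q.1 ^ 2 + q.2 ^ 2 < δ / 2) :
    ∫⁻ z in Set.Icc (-R) R, ∫⁻ x, ENNReal.ofReal (BT T μ (x, z) q) ≤
      ENNReal.ofReal (4 * R * (16 * (6 / k) * Real.log (μ / T))) := by
  set c := μ - q.1 ^ 2 - q.2 ^ 2 with hc
  have hK : 0 ≤ 6 / k := by positivity
  have hrk := continuous_rootKernel hT
  set Λ := ENNReal.ofReal (16 * (6 / k) * Real.log (μ / T)) with hΛ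
  set F : ℝ → ℝ → ENNReal := fun z x => ENNReal.ofReal (6 / k * rootKernel T (c - x ^ 2) z) with hF
  have hFm : Measurable (Function.uncurry F) := by
    refine Measurable.ennreal_ofReal (Continuous.measurable ?_)
    exact continuous_const.mul (hrk.comp (by fun_prop : Continuous fun p : ℝ × ℝ =>
      (c - p.2 ^ 2, p.1)))
  have hpt : ∀ z x, ENNReal.ofReal (BT T μ (x, z) q) ≤
      ENNReal.ofReal (6 / k * rootKernel T (c - z ^ 2) x) +
        (Set.Icc (-R) R).indicator (F z) x := by
    intro z x
    by_cases hx : k ^ 2 ≤ x ^ 2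
    · refine le_add_right (ENNReal.ofReal_le_ofReal ?_)
      exact BT_le_rootKernel_fst hT (by linarith) hk hk1 (.inl hx)
    · have hxR : x ∈ Set.Icc (-R) R := abs_le.1 (abs_le_of_sq_le_sq (by nlinarith) hR)
      rw [Set.indicator_of_mem hxR]
      refine le_add_left (ENNReal.ofReal_le_ofReal ?_)
      exact BT_le_rootKernel_snd hT (by linarith) hk hk1 (.inr (by nlinarith))
  have hvol : volume (Set.Icc (-R) R) = ENNReal.ofReal (2 * R) := by
    rw [Real.volume_Icc]; congr 1; ring
  have hinner : ∀ z, ∫⁻ x, ENNReal.ofReal (BT T μ (x, z) q) ≤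
      Λ + ∫⁻ x in Set.Icc (-R) R, F z x := by
    intro z
    refine (lintegral_mono (hpt z)).trans ?_
    rw [lintegral_add_left, lintegral_indicator measurableSet_Icc]
    · gcongr
      exact lintegral_mul_rootKernel_le hT hT2 hμ hTμ hK _
    · exact (continuous_const.mul (hrk.comp (by fun_prop : Continuous fun x : ℝ =>
        (c - z ^ 2, x)))).measurable.ennreal_ofReal
  calc ∫⁻ z in Set.Icc (-R) R, ∫⁻ x, ENNReal.ofReal (BT T μ (x, z) q)
      ≤ ∫⁻ z in Set.Icc (-R) R, (Λ + ∫⁻ x in Set.Icc (-R) R, F z x) := lintegral_mono hinner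
    _ = Λ * volume (Set.Icc (-R) R) +
        ∫⁻ x in Set.Icc (-R) R, ∫⁻ z in Set.Icc (-R) R, F z x := by
      rw [lintegral_add_left measurable_const, setLIntegral_const,
        lintegral_lintegral_swap hFm.aemeasurable]
    _ ≤ Λ * volume (Set.Icc (-R) R) + ∫⁻ x in Set.Icc (-R) R, Λ := by
      gcongr with x
      exact (setLIntegral_le_lintegral _ _).trans
        (lintegral_mul_rootKernel_le hT hT2 hμ hTμ hK _)
    _ = ENNReal.ofReal (4 * R * (16 * (6 / k) * Real.log (μ / T))) := by
      rw [setLIntegral_const, hvol, hΛ, ← ENNReal.ofReal_mul (by positivity),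
        ← ENNReal.ofReal_add (by positivity) (by positivity)]
      congr 1
      ring

theorem lintegral_prod_prod_mul {A B : ℝ × ℝ → ENNReal} {c : ℝ → ENNReal} (hA : Measurable A)
    (hB : Measurable B) (hc : Measurable c) :
    ∫⁻ p : ℝ × ℝ × ℝ, c p.2.2 * (A (p.1, p.2.2) * B (p.2.1, p.2.2)) =
      ∫⁻ z, c z * ((∫⁻ x, A (x, z)) * ∫⁻ y, B (y, z)) := by
  have hAx : ∀ z, Measurable fun x => A (x, z) := fun z => hA.comp (by fun_prop)
  have hBy : ∀ z, Measurable fun y => B (y, z) := fun z => hB.comp (by fun_prop)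
  have hI : Measurable fun z => ∫⁻ x, A (x, z) := hA.lintegral_prod_left'
  rw [Measure.volume_eq_prod, lintegral_prod_symm' _ (by fun_prop)]
  have h1 : ∀ y : ℝ × ℝ, ∫⁻ x, c y.2 * (A (x, y.2) * B (y.1, y.2)) =
      c y.2 * ((∫⁻ x, A (x, y.2)) * B (y.1, y.2)) := by
    intro y
    rw [lintegral_const_mul _ (by fun_prop), lintegral_mul_const _ (hAx _)]
  simp_rw [h1]
  rw [Measure.volume_eq_prod, lintegral_prod_symm' _ (by fun_prop)]
  refine lintegral_congr fun z => ?_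
  dsimp only
  rw [lintegral_const_mul _ (by fun_prop), lintegral_const_mul _ (hBy _)]

/-- An integrable weight `w` on `ℝ` with `w x * w y * w z` dominating
`1 / ((1 + x² + z²) (1 + y² + z²))`. -/
noncomputable def decayWeight (x : ℝ) : ℝ := (1 + x ^ 2) ^ (-(2 / 3 : ℝ))

theorem decayWeight_pos (x : ℝ) : 0 < decayWeight x := by
  unfold decayWeight; positivity

theorem continuous_decayWeight : Continuous decayWeight := by
  unfold decayWeight
  exact Continuous.rpow_const (by fun_prop) fun x => .inl (by positivity)

theorem integrable_decayWeight : Integrable decayWeight := by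
  have h := integrable_rpow_neg_one_add_norm_sq (E := ℝ) (μ := volume) (r := 4 / 3)
    (by simp; norm_num)
  refine h.congr (.of_forall fun x => ?_)
  simp only [decayWeight, Real.norm_eq_abs, sq_abs]
  norm_num

theorem one_div_le_decayWeight (x z : ℝ) :
    1 / (1 + x ^ 2 + z ^ 2) ≤ decayWeight x * (1 + z ^ 2) ^ (-(1 / 3 : ℝ)) := by
  have hA : 0 < 1 + x ^ 2 + z ^ 2 := by positivity
  have h : (1 + x ^ 2 + z ^ 2) ^ (-(2 / 3 : ℝ)) * (1 + x ^ 2 + z ^ 2) ^ (-(1 / 3 : ℝ)) =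
      1 / (1 + x ^ 2 + z ^ 2) := by
    rw [← Real.rpow_add hA, show -(2 / 3 : ℝ) + -(1 / 3) = -1 by norm_num, Real.rpow_neg_one,
      one_div]
  rw [← h]
  unfold decayWeight
  refine mul_le_mul ?_ ?_ (by positivity) (by positivity)
  · exact Real.rpow_le_rpow_of_nonpos (by positivity) (by nlinarith [sq_nonneg z]) (by norm_num)
  · exact Real.rpow_le_rpow_of_nonpos (by positivity) (by nlinarith [sq_nonneg x]) (by norm_num)

theorem one_div_mul_one_div_le_decayWeight (x y z : ℝ) :
    1 / (1 + x ^ 2 + z ^ 2) * (1 / (1 + y ^ 2 + z ^ 2)) ≤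
      decayWeight z * (decayWeight x * decayWeight y) := by
  have hz : (1 + z ^ 2) ^ (-(1 / 3 : ℝ)) * (1 + z ^ 2) ^ (-(1 / 3 : ℝ)) = decayWeight z := by
    rw [← Real.rpow_add (by positivity), decayWeight]
    norm_num
  calc _ ≤ (decayWeight x * (1 + z ^ 2) ^ (-(1 / 3 : ℝ))) *
        (decayWeight y * (1 + z ^ 2) ^ (-(1 / 3 : ℝ))) :=
        mul_le_mul (one_div_le_decayWeight x z) (one_div_le_decayWeight y z) (by positivity)
          (mul_nonneg (decayWeight_pos x).le (by positivity))
    _ = _ := by rw [← hz]; ring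

/-- Off the excluded set, the product of two `B_T` factors is controlled by four terms, each a
product of a function of `(x, z)`, a function of `(y, z)` and a function of `z`. -/
theorem indicator_mul_BT_mul_BT_le {T μ δ R : ℝ} (hT : 0 < T) (hδ : 0 < δ) (hδμ : δ < μ)
    (hR : 0 ≤ R) (hμR : 2 * μ ≤ R ^ 2) (q q' : ℝ × ℝ) (x y z : ℝ) :
    ENNReal.ofReal ((if (μ - δ < z ^ 2 ∧ z ^ 2 < μ + δ) ∧ x ^ 2 < 4 * δ ∧ y ^ 2 < 4 * δ
        then (0 : ℝ) else 1) * (BT T μ (x, z) q * BT T μ (y, z) q')) ≤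
      {z : ℝ | z ^ 2 ≤ μ - δ}.indicator 1 z *
          (ENNReal.ofReal (BT T μ (x, z) q) * ENNReal.ofReal (BT T μ (y, z) q')) +
        (ENNReal.ofReal ((2 * (1 + μ + δ) / δ) ^ 2 * decayWeight z) *
          (ENNReal.ofReal (decayWeight x) * ENNReal.ofReal (decayWeight y)) +
        ((Set.Icc (-R) R).indicator 1 z * (ENNReal.ofReal (BT T μ (x, z) q) *
          ENNReal.ofReal (2 * (1 + 4 * δ) / (3 * δ) * (1 + y ^ 2)⁻¹)) +
        (Set.Icc (-R) R).indicator 1 z *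
          (ENNReal.ofReal (2 * (1 + 4 * δ) / (3 * δ) * (1 + x ^ 2)⁻¹) *
            ENNReal.ofReal (BT T μ (y, z) q')))) := by
  have hB := (BT_mem_Icc μ hT (x, z) q).1
  have hB' := (BT_mem_Icc μ hT (y, z) q').1
  split_ifs with hc
  · simp
  rw [one_mul]
  have hfar : ∀ {t : ℝ} {r : ℝ × ℝ}, μ - δ < z ^ 2 → 4 * δ ≤ t ^ 2 →
      BT T μ (t, z) r ≤ 2 * (1 + 4 * δ) / (3 * δ) * (1 + t ^ 2)⁻¹ := by
    intro t r h1 h2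
    have h : 3 * δ / (1 + 4 * δ) * (1 + t ^ 2) ≤ t ^ 2 + z ^ 2 - μ := by
      rw [div_mul_eq_mul_div, div_le_iff₀ (by positivity)]
      nlinarith [mul_le_mul_of_nonneg_left h2 hδ.le]
    refine (BT_le_two_div hT (by positivity) h).trans_eq ?_
    field_simp
  rcases le_or_gt (z ^ 2) (μ - δ) with hz | hz
  · refine le_add_right ?_
    rw [Set.indicator_of_mem (by exact hz), Pi.one_apply, one_mul, ENNReal.ofReal_mul hB]
  refine le_add_left ?_
  rcases le_or_gt (μ + δ) (z ^ 2) with hz' | hz'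
  · refine le_add_right ?_
    have hout : ∀ {t : ℝ} {r : ℝ × ℝ},
        BT T μ (t, z) r ≤ 2 * (1 + μ + δ) / δ * (1 / (1 + t ^ 2 + z ^ 2)) := by
      intro t r
      have h : δ / (1 + μ + δ) * (1 + t ^ 2 + z ^ 2) ≤ t ^ 2 + z ^ 2 - μ := by
        rw [div_mul_eq_mul_div, div_le_iff₀ (by linarith)]
        nlinarith [sq_nonneg t]
      have hμ : 0 < μ := hδ.trans hδμ
      refine (BT_le_two_div hT (by positivity) h).trans_eq ?_
      field_simp
    rw [← ENNReal.ofReal_mul (decayWeight_pos x).le, ← ENNReal.ofReal_mul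
      (mul_nonneg (sq_nonneg _) (decayWeight_pos z).le)]
    refine ENNReal.ofReal_le_ofReal ?_
    refine (mul_le_mul hout hout hB' (hB.trans hout)).trans ?_
    have h := mul_le_mul_of_nonneg_left (one_div_mul_one_div_le_decayWeight x y z)
      (sq_nonneg (2 * (1 + μ + δ) / δ))
    refine le_trans (le_of_eq ?_) (h.trans (le_of_eq ?_)) <;> ring
  refine le_add_left ?_
  have hzR : z ∈ Set.Icc (-R) R := abs_le.1 (abs_le_of_sq_le_sq (by linarith) hR)
  rw [Set.indicator_of_mem hzR, Pi.one_apply, one_mul, one_mul, ENNReal.ofReal_mul hB]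
  rcases le_or_gt (4 * δ) (y ^ 2) with hy | hy
  · refine le_add_right ?_
    gcongr
    exact hfar hz hy
  · refine le_add_left ?_
    have hx : 4 * δ ≤ x ^ 2 := not_lt.1 fun hx => hc ⟨⟨hz, hz'⟩, hx, hy⟩
    gcongr
    exact hfar hz hx

theorem integral_BT_mul_BT_le {T μ δ k R : ℝ} (hT : 0 < T) (hT2 : T ≤ 1 / 2)
    (hTμ : T ≤ μ ^ 2) (hL : 0 ≤ Real.log (μ / T)) (hk : 0 < k) (hk1 : k ≤ 1) (hkδ : k ^ 2 ≤ δ / 4)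
    (hδ : 0 < δ) (hδμ : δ < μ) (hR : 0 ≤ R) (hμR : 2 * μ ≤ R ^ 2) {q q' : ℝ × ℝ}
    (hq : q.1 ^ 2 + q.2 ^ 2 < δ / 2) (hq' : q'.1 ^ 2 + q'.2 ^ 2 < δ / 2) :
    (∫ x : ℝ × ℝ × ℝ, (if (μ - δ < x.2.2 ^ 2 ∧ x.2.2 ^ 2 < μ + δ) ∧
        x.1 ^ 2 < 4 * δ ∧ x.2.1 ^ 2 < 4 * δ then (0 : ℝ) else 1) *
          (BT T μ (x.1, x.2.2) q * BT T μ (x.2.1, x.2.2) q')) ≤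
      2 * R * (16 * (6 / k) * Real.log (μ / T)) ^ 2 +
        ((2 * (1 + μ + δ) / δ) ^ 2 * (∫ x, decayWeight x) ^ 3 +
        2 * (4 * R * (16 * (6 / k) * Real.log (μ / T)) *
          (2 * (1 + 4 * δ) / (3 * δ) * π))) := by
  have hμ : 0 < μ := hδ.trans hδμ
  have hW : 0 ≤ ∫ x, decayWeight x := integral_nonneg fun x => (decayWeight_pos x).le
  have hbm : ∀ r, Measurable fun p : ℝ × ℝ => ENNReal.ofReal (BT T μ p r) := fun r =>
    (measurable_BT T μ r).ennreal_ofReal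
  have hdm : Measurable decayWeight := continuous_decayWeight.measurable
  have hwm : Measurable fun x => ENNReal.ofReal (decayWeight x) := hdm.ennreal_ofReal
  have hwm1 : Measurable fun p : ℝ × ℝ => ENNReal.ofReal (decayWeight p.1) :=
    hwm.comp measurable_fst
  have hwmz : Measurable fun x =>
      ENNReal.ofReal ((2 * (1 + μ + δ) / δ) ^ 2 * decayWeight x) :=
    (hdm.const_mul _).ennreal_ofReal
  set M := 2 * (1 + 4 * δ) / (3 * δ) with hM
  have hM0 : 0 ≤ M := by positivity
  have hvm : Measurable fun p : ℝ × ℝ => ENNReal.ofReal (M * (1 + p.1 ^ 2)⁻¹) := by fun_prop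
  have hS : MeasurableSet {z : ℝ | z ^ 2 ≤ μ - δ} :=
    measurableSet_le (by fun_prop) measurable_const
  have hSm : Measurable ({z : ℝ | z ^ 2 ≤ μ - δ}.indicator (1 : ℝ → ENNReal)) :=
    measurable_one.indicator hS
  have hIm : Measurable ((Set.Icc (-R) R).indicator (1 : ℝ → ENNReal)) :=
    measurable_one.indicator measurableSet_Icc
  have hvol : volume (Set.Icc (-R) R) = ENNReal.ofReal (2 * R) := by
    rw [Real.volume_Icc]; congr 1; ring
  have hv : ∫⁻ y : ℝ, ENNReal.ofReal (M * (1 + y ^ 2)⁻¹) = ENNReal.ofReal (M * π) := by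
    rw [← ofReal_integral_eq_lintegral_ofReal (integrable_inv_one_add_sq.const_mul M)
      (.of_forall fun y => by positivity), integral_const_mul, integral_univ_inv_one_add_sq]
  have hw : ∫⁻ x, ENNReal.ofReal (decayWeight x) = ENNReal.ofReal (∫ x, decayWeight x) :=
    (ofReal_integral_eq_lintegral_ofReal integrable_decayWeight
      (.of_forall fun x => (decayWeight_pos x).le)).symm
  set Λ := 16 * (6 / k) * Real.log (μ / T) with hΛ
  have hΛ0 : 0 ≤ Λ := by positivity
  have hstrip : ∀ r : ℝ × ℝ, r.1 ^ 2 + r.2 ^ 2 < δ / 2 →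
      ∫⁻ z, (Set.Icc (-R) R).indicator (1 : ℝ → ENNReal) z *
        ∫⁻ x, ENNReal.ofReal (BT T μ (x, z) r) ≤ ENNReal.ofReal (4 * R * Λ) := by
    intro r hr
    refine le_trans (le_of_eq ?_) (lintegral_BT_strip_le hT hT2 hμ hTμ hL hk hk1 hkδ hδμ hR
      (by linarith) hr)
    rw [← lintegral_indicator measurableSet_Icc]
    refine lintegral_congr fun z => ?_
    by_cases hz : z ∈ Set.Icc (-R) R
    · rw [Set.indicator_of_mem hz, Set.indicator_of_mem hz, Pi.one_apply, one_mul]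
    · rw [Set.indicator_of_notMem hz, Set.indicator_of_notMem hz, zero_mul]
  have hslice : ∫⁻ z, {z : ℝ | z ^ 2 ≤ μ - δ}.indicator (1 : ℝ → ENNReal) z *
      ((∫⁻ x, ENNReal.ofReal (BT T μ (x, z) q)) * ∫⁻ y, ENNReal.ofReal (BT T μ (y, z) q')) ≤
        ENNReal.ofReal (2 * R * Λ ^ 2) := by
    calc _ ≤ ∫⁻ z, (Set.Icc (-R) R).indicator (fun _ => ENNReal.ofReal (Λ ^ 2)) z := by
          refine lintegral_mono fun z => ?_
          by_cases hz : z ∈ {z : ℝ | z ^ 2 ≤ μ - δ}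
          · have hz2 : z ^ 2 ≤ μ - δ := hz
            have hzR : z ∈ Set.Icc (-R) R := abs_le.1 (abs_le_of_sq_le_sq (by linarith) hR)
            rw [Set.indicator_of_mem hz, Pi.one_apply, one_mul, Set.indicator_of_mem hzR, sq,
              ENNReal.ofReal_mul hΛ0]
            exact mul_le_mul' (lintegral_BT_slice_le hT hT2 hμ hTμ hk hk1 hkδ hq hz2)
              (lintegral_BT_slice_le hT hT2 hμ hTμ hk hk1 hkδ hq' hz2)
          · rw [Set.indicator_of_notMem hz, zero_mul]
            exact zero_le
      _ = _ := by
          rw [lintegral_indicator measurableSet_Icc, setLIntegral_const, hvol,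
            ← ENNReal.ofReal_mul (by positivity), mul_comm]
  rw [integral_eq_lintegral_of_nonneg_ae]
  rotate_left
  · refine .of_forall fun x => mul_nonneg ?_
      (mul_nonneg (BT_mem_Icc μ hT _ q).1 (BT_mem_Icc μ hT _ q').1)
    split_ifs <;> simp
  · refine Measurable.aestronglyMeasurable (.mul (.ite ?_ measurable_const measurable_const)
      (((measurable_BT T μ q).comp (by fun_prop)).mul ((measurable_BT T μ q').comp (by fun_prop))))
    simp only [measurableSet_setOfPred]
    fun_prop
  refine ENNReal.toReal_le_of_le_ofReal (by positivity) ?_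
  refine (lintegral_mono fun p : ℝ × ℝ × ℝ => indicator_mul_BT_mul_BT_le hT hδ hδμ hR hμR q q'
    p.1 p.2.1 p.2.2).trans ?_
  have hbx : ∀ r, Measurable fun p : ℝ × ℝ × ℝ => ENNReal.ofReal (BT T μ (p.1, p.2.2) r) :=
    fun r => (hbm r).comp (by fun_prop)
  have hby : ∀ r, Measurable fun p : ℝ × ℝ × ℝ => ENNReal.ofReal (BT T μ (p.2.1, p.2.2) r) :=
    fun r => (hbm r).comp (by fun_prop)
  rw [lintegral_add_left (by fun_prop), lintegral_add_left (by fun_prop),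
    lintegral_add_left (by fun_prop), lintegral_prod_prod_mul (hbm q) (hbm q') hSm,
    lintegral_prod_prod_mul hwm1 hwm1 hwmz, lintegral_prod_prod_mul (hbm q) hvm hIm,
    lintegral_prod_prod_mul hvm (hbm q') hIm]
  dsimp only
  rw [ENNReal.ofReal_add (by positivity) (by positivity),
    ENNReal.ofReal_add (by positivity) (by positivity)]
  refine add_le_add hslice (add_le_add (le_of_eq ?_) ?_)
  · simp_rw [ENNReal.ofReal_mul (sq_nonneg (2 * (1 + μ + δ) / δ)), hw]
    rw [lintegral_mul_const _ (by fun_prop), lintegral_const_mul _ hwm, hw,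
      ← ENNReal.ofReal_mul hW, ← ENNReal.ofReal_mul (by positivity),
      ← ENNReal.ofReal_mul (by positivity), ← ENNReal.ofReal_mul (by positivity)]
    congr 1
    ring
  · have hJ : ∀ r, Measurable fun z => ∫⁻ x, ENNReal.ofReal (BT T μ (x, z) r) :=
      fun r => (hbm r).lintegral_prod_left'
    rw [two_mul, ENNReal.ofReal_add (by positivity) (by positivity),
      ENNReal.ofReal_mul (by positivity), hv]
    simp_rw [mul_comm (ENNReal.ofReal (M * π)) (lintegral _ _), ← mul_assoc]
    rw [lintegral_mul_const _ (by fun_prop), lintegral_mul_const _ (by fun_prop)]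
    gcongr
    · exact hstrip q hq
    · exact hstrip q' hq'

/-- Away from the set `μ−δ₁ < p₂² < μ+δ₁, p₁² < 4δ₁, p₁'² < 4δ₁`, the product integral of
two `B_T` factors with small arguments `q, q'` is `O((log(μ/T))^{5/2})` as `T → 0`.
The integration variable is `x = (p₁, p₁', p₂)`. -/
theorem BT_product_integral_restricted_bound (μ δ₁ : ℝ) (hμ : 0 < μ)
    (hδ₁ : 0 < δ₁) (hδ₁μ : δ₁ < μ) :
    ∃ δ₂ > (0 : ℝ), ∃ C > (0 : ℝ), ∃ T₀ : ℝ, 0 < T₀ ∧ T₀ < μ ∧ ∀ T, 0 < T → T < T₀ →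
      ∀ q q' : ℝ × ℝ, Real.sqrt (q.1 ^ 2 + q.2 ^ 2) < δ₂ →
        Real.sqrt (q'.1 ^ 2 + q'.2 ^ 2) < δ₂ →
        (∫ x : ℝ × ℝ × ℝ,
            (if (μ - δ₁ < x.2.2 ^ 2 ∧ x.2.2 ^ 2 < μ + δ₁) ∧
                x.1 ^ 2 < 4 * δ₁ ∧ x.2.1 ^ 2 < 4 * δ₁ then (0 : ℝ) else 1) *
              (BT T μ (x.1, x.2.2) q * BT T μ (x.2.1, x.2.2) q')) ≤
          C * (Real.log (μ / T)) ^ ((5 : ℝ) / 2) := by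
  set k := min 1 √(δ₁ / 4) with hkdef
  have hk : 0 < k := lt_min one_pos (by positivity)
  have hkδ : k ^ 2 ≤ δ₁ / 4 := (Real.le_sqrt' hk).1 (min_le_right _ _)
  set W := ∫ x, decayWeight x with hWdef
  have hW : 0 ≤ W := integral_nonneg fun x => (decayWeight_pos x).le
  set E := 16 * (6 / k) with hE
  have hE0 : 0 < E := by positivity
  set A := 2 * (1 + μ) * E ^ 2 with hA
  set B := (2 * (1 + μ + δ₁) / δ₁) ^ 2 * W ^ 3 with hB
  set D := 2 * (4 * (1 + μ) * E * (2 * (1 + 4 * δ₁) / (3 * δ₁) * π)) with hD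
  have hA0 : 0 < A := by positivity
  have hB0 : 0 ≤ B := by positivity
  have hD0 : 0 < D := by positivity
  refine ⟨√(δ₁ / 2), by positivity, A + B + D, by positivity, min (1 / 2) (min (μ / 3) (μ ^ 2)),
    by positivity, (min_le_right _ _).trans_lt ((min_le_left _ _).trans_lt (by linarith)), ?_⟩
  intro T hT hT0 q q' hq hq'
  obtain ⟨hT2, hT0⟩ := lt_min_iff.1 hT0
  obtain ⟨hT3, hTμ⟩ := lt_min_iff.1 hT0
  rw [Real.sqrt_lt_sqrt_iff (by positivity)] at hq hq'
  have hL : 1 ≤ Real.log (μ / T) := by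
    rw [Real.le_log_iff_exp_le (by positivity)]
    refine Real.exp_one_lt_three.le.trans ?_
    rw [le_div_iff₀ hT]
    linarith
  refine (integral_BT_mul_BT_le (R := 1 + μ) hT hT2.le hTμ.le (by linarith) hk (min_le_left _ _)
    hkδ hδ₁ hδ₁μ (by linarith) (by nlinarith) hq hq').trans ?_
  set L := Real.log (μ / T) with hLdef
  have h2 : L ^ 2 ≤ L ^ ((5 : ℝ) / 2) := by
    rw [← Real.rpow_natCast]
    exact Real.rpow_le_rpow_of_exponent_le hL (by norm_num)
  have h1 : L ≤ L ^ 2 := by nlinarith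
  calc _ = A * L ^ 2 + B + D * L := by rw [hA, hB, hD]; ring
    _ ≤ A * L ^ ((5 : ℝ) / 2) + B * L ^ ((5 : ℝ) / 2) + D * L ^ ((5 : ℝ) / 2) := by
      gcongr
      · nlinarith
      · linarith
    _ = _ := by ring
end

section
/- Let μ>0 and let ξ, ξ' : (0,∞) → ℝ be functions with ξ(T) → 0 and ξ'(T) → 0 as T → 0⁺. Then there exist constants C > 0 and T₀ ∈ (0,μ) such that for all 0 < T < T₀, sup_{q₁∈ℝ} ∫_ℝ B_T((p₁, ξ(T)), (q₁, ξ'(T))) dp₁ ≤ C · log(μ/T). -/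
open MeasureTheory Real Filter

theorem tanh_eq_one_sub_two_div (x : ℝ) : Real.tanh x = 1 - 2 / (Real.exp (2 * x) + 1) := by
  have h : Real.exp (2 * x) = Real.exp x * Real.exp x := by rw [← Real.exp_add]; ring_nf
  have hx := Real.exp_pos x
  rw [Real.tanh_eq, Real.exp_neg, h]
  field_simp
  ring

theorem tanh_le_tanh_of_le {x y : ℝ} (h : x ≤ y) : Real.tanh x ≤ Real.tanh y := by
  rw [tanh_eq_one_sub_two_div, tanh_eq_one_sub_two_div]
  have : Real.exp (2 * x) ≤ Real.exp (2 * y) := Real.exp_le_exp.2 (by linarith)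
  gcongr

/-- The increments of `tanh` on `[z, ∞)`, `0 ≤ z`, are at most `2 / (1 + z)` times the length. -/
theorem tanh_sub_tanh_le {x z : ℝ} (hz : 0 ≤ z) (hzx : z ≤ x) :
    Real.tanh x - Real.tanh z ≤ (x - z) * (2 / (1 + z)) := by
  set A := Real.exp (2 * z) with hA
  set B := Real.exp (2 * x) with hB
  have hApos : 0 < A := Real.exp_pos _
  have hAz : 2 * z + 1 ≤ A := Real.add_one_le_exp _
  have hAB : A ≤ B := Real.exp_le_exp.2 (by linarith)
  have hratio : B - A ≤ 2 * (x - z) * B := by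
    have h1 : A = B * Real.exp (-(2 * (x - z))) := by
      rw [hA, hB, ← Real.exp_add]; ring_nf
    have h2 : 1 - 2 * (x - z) ≤ Real.exp (-(2 * (x - z))) := by
      linarith [Real.add_one_le_exp (-(2 * (x - z)))]
    nlinarith
  have hle : (B - A) * (1 + z) ≤ (x - z) * ((B + 1) * (A + 1)) := by
    have h1 : (B - A) * (1 + z) ≤ 2 * (x - z) * B * (1 + z) :=
      mul_le_mul_of_nonneg_right hratio (by linarith)
    have h2 : 2 * (x - z) * B * (1 + z) ≤ (x - z) * B * (A + 1) := by
      have : 0 ≤ (x - z) * B := mul_nonneg (by linarith) (by linarith)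
      nlinarith
    have h3 : 0 ≤ (x - z) * (A + 1) := mul_nonneg (by linarith) (by linarith)
    nlinarith
  have hz1 : 0 < 1 + z := by linarith
  have hA1 : 0 < A + 1 := by linarith
  have hB1 : 0 < B + 1 := by linarith
  have key : (x - z) * (2 / (1 + z)) - (Real.tanh x - Real.tanh z) =
      2 * ((x - z) * ((B + 1) * (A + 1)) - (B - A) * (1 + z)) /
        ((1 + z) * ((B + 1) * (A + 1))) := by
    rw [tanh_eq_one_sub_two_div x, tanh_eq_one_sub_two_div z, ← hA, ← hB]
    field_simp
    ring
  have : 0 ≤ 2 * ((x - z) * ((B + 1) * (A + 1)) - (B - A) * (1 + z)) /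
        ((1 + z) * ((B + 1) * (A + 1))) :=
    div_nonneg (by linarith) (by positivity)
  linarith

theorem tanh_le_three_mul_div {x : ℝ} (hx : 0 ≤ x) : Real.tanh x ≤ x * (3 / (1 + x)) := by
  have h1 := Real.tanh_lt_one x
  have h2 : Real.tanh x ≤ 2 * x := by
    have := tanh_sub_tanh_le le_rfl hx
    simp only [Real.tanh_zero] at this
    linarith
  rw [← mul_div_assoc, le_div_iff₀ (by linarith)]
  nlinarith

theorem tanh_add_tanh_nonneg {x y : ℝ} (h : 0 ≤ x + y) : 0 ≤ Real.tanh x + Real.tanh y := by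
  have := tanh_le_tanh_of_le (show -y ≤ x by linarith)
  rw [Real.tanh_neg] at this
  linarith

theorem tanh_add_tanh_le {x y : ℝ} (h : 0 ≤ x + y) :
    Real.tanh x + Real.tanh y ≤ (x + y) * (3 / (1 + |x|) + 3 / (1 + |y|)) := by
  wlog hxy : y ≤ x generalizing x y
  · have := this (x := y) (y := x) (by linarith) (by linarith)
    linarith
  have hx : 0 ≤ x := by linarith
  have hx3 : 0 ≤ 3 / (1 + |x|) := by positivity
  have hy3 : 0 ≤ 3 / (1 + |y|) := by positivity
  rcases le_total 0 y with hy | hy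
  · rw [abs_of_nonneg hx, abs_of_nonneg hy] at *
    nlinarith [tanh_le_three_mul_div hx, tanh_le_three_mul_div hy]
  · have := tanh_sub_tanh_le (x := x) (z := -y) (by linarith) (by linarith)
    rw [Real.tanh_neg] at this
    have hy2 : 2 / (1 + -y) ≤ 3 / (1 + |y|) := by
      rw [abs_of_nonpos hy]
      have : 0 < 1 + -y := by linarith
      gcongr
      norm_num
    nlinarith [mul_nonneg h hx3, mul_le_mul_of_nonneg_left hy2 h]

theorem tanh_add_tanh_div_nonneg (x y : ℝ) : 0 ≤ (Real.tanh x + Real.tanh y) / (x + y) := by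
  rcases le_total 0 (x + y) with h | h
  · exact div_nonneg (tanh_add_tanh_nonneg h) h
  · refine div_nonneg_of_nonpos ?_ h
    have := tanh_add_tanh_nonneg (x := -x) (y := -y) (by linarith)
    simp only [Real.tanh_neg] at this
    linarith

theorem tanh_add_tanh_div_le (x y : ℝ) :
    (Real.tanh x + Real.tanh y) / (x + y) ≤ 3 / (1 + |x|) + 3 / (1 + |y|) := by
  rcases lt_trichotomy (x + y) 0 with h | h | h
  · have := tanh_add_tanh_le (x := -x) (y := -y) (by linarith)
    simp only [Real.tanh_neg, abs_neg] at this
    rw [div_le_iff_of_neg h]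
    linarith
  · rw [h, div_zero]
    positivity
  · rw [div_le_iff₀ h]
    linarith [tanh_add_tanh_le h.le]

theorem BT_eq_div {T : ℝ} (hT : 0 < T) (μ : ℝ) (p q : ℝ × ℝ) :
    BT T μ p q =
      (Real.tanh (((p.1 + q.1) ^ 2 + (p.2 + q.2) ^ 2 - μ) / (2 * T)) +
        Real.tanh (((p.1 - q.1) ^ 2 + (p.2 - q.2) ^ 2 - μ) / (2 * T))) /
      (((p.1 + q.1) ^ 2 + (p.2 + q.2) ^ 2 - μ) / (2 * T) +
        ((p.1 - q.1) ^ 2 + (p.2 - q.2) ^ 2 - μ) / (2 * T)) / (2 * T) := by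
  have hden : ((p.1 + q.1) ^ 2 + (p.2 + q.2) ^ 2 - μ) / (2 * T) +
      ((p.1 - q.1) ^ 2 + (p.2 - q.2) ^ 2 - μ) / (2 * T) =
      2 * (p.1 ^ 2 + p.2 ^ 2 + q.1 ^ 2 + q.2 ^ 2 - μ) / (2 * T) := by ring
  rw [hden, div_div, div_mul_cancel₀ _ (by positivity)]
  unfold BT
  split_ifs with h
  · rw [h]
    simp
  · rfl

theorem BT_nonneg {T : ℝ} (hT : 0 < T) (μ : ℝ) (p q : ℝ × ℝ) : 0 ≤ BT T μ p q := by
  rw [BT_eq_div hT]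
  exact div_nonneg (tanh_add_tanh_div_nonneg _ _) (by positivity)

theorem BT_le {T : ℝ} (hT : 0 < T) (μ : ℝ) (p q : ℝ × ℝ) :
    BT T μ p q ≤ 3 / (2 * T + |(p.1 + q.1) ^ 2 + (p.2 + q.2) ^ 2 - μ|) +
      3 / (2 * T + |(p.1 - q.1) ^ 2 + (p.2 - q.2) ^ 2 - μ|) := by
  have h2T : 0 < 2 * T := by positivity
  have hscale (X : ℝ) : 3 / (1 + |X / (2 * T)|) = 3 / (2 * T + |X|) * (2 * T) := by
    have : 0 < 2 * T + |X| := by positivity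
    rw [abs_div, abs_of_pos h2T]
    field_simp
  rw [BT_eq_div hT, div_le_iff₀ h2T]
  refine (tanh_add_tanh_div_le _ _).trans_eq ?_
  rw [hscale, hscale]
  ring

section Kernel

variable {α β : ℝ}

theorem hasDerivAt_log_div_div_sub (hα : 0 < α) (hαβ : α < β) {x : ℝ} (hx : 0 ≤ x) :
    HasDerivAt (fun u => Real.log ((u + α) / (u + β)) / (β - α)) (1 / ((x + α) * (x + β))) x := by
  have h1 : 0 < x + α := by linarith
  have h2 : 0 < x + β := by linarith
  have h3 : 0 < β - α := by linarith
  have hd := ((((hasDerivAt_id x).add_const α).div ((hasDerivAt_id x).add_const β)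
    h2.ne').log (div_pos h1 h2).ne').div_const (β - α)
  refine hd.congr_deriv ?_
  simp only [id, Pi.div_apply]
  field_simp
  ring

theorem tendsto_log_div_div_sub (α β : ℝ) :
    Tendsto (fun u => Real.log ((u + α) / (u + β)) / (β - α)) atTop (nhds 0) := by
  have h : Tendsto (fun u : ℝ => 1 + (α - β) / (u + β)) atTop (nhds (1 + 0)) :=
    tendsto_const_nhds.add
      (tendsto_const_nhds.div_atTop (tendsto_atTop_add_const_right _ _ tendsto_id))
  have h' : Tendsto (fun u : ℝ => (u + α) / (u + β)) atTop (nhds 1) := by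
    rw [add_zero] at h
    refine h.congr' ?_
    filter_upwards [eventually_gt_atTop (-β)] with u hu
    have : u + β ≠ 0 := by linarith
    field_simp
    ring
  simpa using (h'.log one_ne_zero).div_const (β - α)

theorem integral_one_div_abs_add_mul (hα : 0 < α) (hαβ : α < β) :
    ∫ u : ℝ, 1 / ((|u| + α) * (|u| + β)) = 2 * (Real.log (β / α) / (β - α)) := by
  rw [integral_comp_abs (f := fun u => 1 / ((u + α) * (u + β))),
    integral_Ioi_of_hasDerivAt_of_nonneg'
      (fun x hx => hasDerivAt_log_div_div_sub hα hαβ hx) ?_ (tendsto_log_div_div_sub α β)]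
  · rw [zero_add, zero_add, ← inv_div β α, Real.log_inv]
    ring
  · intro x hx
    have : 0 < x := hx
    have : 0 < β := hα.trans hαβ
    positivity

theorem integrable_one_div_abs_add_mul (hα : 0 < α) (hαβ : α < β) :
    Integrable fun u : ℝ => 1 / ((|u| + α) * (|u| + β)) := by
  have hint := integral_one_div_abs_add_mul hα hαβ
  refine Integrable.of_integral_ne_zero ?_
  rw [hint]
  have : 0 < Real.log (β / α) := Real.log_pos ((one_lt_div hα).2 hαβ)
  have : 0 < β - α := by linarith
  positivity

/-- Near each of the two zeros `±√d` of `x² - d`, the regularised reciprocal of `|x² - d|` is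
dominated by an explicit integrable kernel. -/
theorem one_div_add_abs_sq_sub_le (hα : 0 < α) (hαβ : α ≤ β) {t r : ℝ} (ht : α * β ≤ 4 * t)
    (hr : 2 * β ≤ r) (x : ℝ) :
    1 / (2 * t + |x ^ 2 - r ^ 2|) ≤
      2 * (1 / ((|x - r| + α) * (|x - r| + β))) + 2 * (1 / ((|x + r| + α) * (|x + r| + β))) := by
  have hβ : 0 < β := by linarith
  have key (u : ℝ) (hu : 0 ≤ u) :
      1 / (2 * t + |u ^ 2 - r ^ 2|) ≤ 2 * (1 / ((|u - r| + α) * (|u - r| + β))) := by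
    have habs : |u ^ 2 - r ^ 2| = |u - r| * (u + r) := by
      rw [show u ^ 2 - r ^ 2 = (u - r) * (u + r) by ring, abs_mul,
        abs_of_nonneg (show 0 ≤ u + r by linarith)]
    have hle : |u - r| ≤ u + r := abs_le.2 ⟨by linarith, by linarith⟩
    have hprod : |u - r| * |u - r| ≤ |u - r| * (u + r) :=
      mul_le_mul_of_nonneg_left hle (abs_nonneg _)
    have hlin : |u - r| * (α + β) ≤ |u - r| * (u + r) :=
      mul_le_mul_of_nonneg_left (by linarith) (abs_nonneg _)
    rw [show 2 * (1 / ((|u - r| + α) * (|u - r| + β))) =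
      1 / ((|u - r| + α) * (|u - r| + β) / 2) by field_simp, habs]
    refine one_div_le_one_div_of_le (by positivity) ?_
    nlinarith
  rcases le_total 0 x with hx | hx
  · have := key x hx
    have : 0 ≤ 2 * (1 / ((|x + r| + α) * (|x + r| + β))) := by positivity
    linarith
  · have h := key (-x) (by linarith)
    rw [neg_sq, show -x - r = -(x + r) by ring, abs_neg] at h
    have : 0 ≤ 2 * (1 / ((|x - r| + α) * (|x - r| + β))) := by positivity
    linarith

end Kernel

/-- A bound on the line integral that is uniform in `q₁`, with the kernel parameters explicit. -/
theorem integral_BT_le {T μ α β a b : ℝ} (hT : 0 < T) (hα : 0 < α) (hαβ : α < β)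
    (hαβT : α * β ≤ 4 * T) (hplus : (a + b) ^ 2 + (2 * β) ^ 2 ≤ μ)
    (hminus : (a - b) ^ 2 + (2 * β) ^ 2 ≤ μ) (q : ℝ) :
    ∫ p : ℝ, BT T μ (p, a) (q, b) ≤ 48 * (Real.log (β / α) / (β - α)) := by
  set k : ℝ → ℝ := fun u => 1 / ((|u| + α) * (|u| + β)) with hk
  have hki : Integrable k := integrable_one_div_abs_add_mul hα hαβ
  have hkI : ∫ u, k u = 2 * (Real.log (β / α) / (β - α)) := integral_one_div_abs_add_mul hα hαβ
  set r := √(μ - (a + b) ^ 2) with hr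
  set s := √(μ - (a - b) ^ 2) with hs
  have hr2 : r ^ 2 = μ - (a + b) ^ 2 := Real.sq_sqrt (by nlinarith)
  have hs2 : s ^ 2 = μ - (a - b) ^ 2 := Real.sq_sqrt (by nlinarith)
  have hrβ : 2 * β ≤ r := Real.le_sqrt_of_sq_le (by linarith)
  have hsβ : 2 * β ≤ s := Real.le_sqrt_of_sq_le (by linarith)
  have hshift (c : ℝ) : Integrable fun p => 6 * k (p + c) := (hki.comp_add_right c).const_mul 6
  have hshiftI (c : ℝ) : ∫ p, 6 * k (p + c) = 12 * (Real.log (β / α) / (β - α)) := by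
    rw [integral_const_mul, integral_add_right_eq_self k c, hkI]
    ring
  have hpair (c d : ℝ) : Integrable fun p => 6 * k (p + c) + 6 * k (p + d) :=
    (hshift c).add (hshift d)
  have hbound (p : ℝ) : BT T μ (p, a) (q, b) ≤
      (6 * k (p + (q - r)) + 6 * k (p + (q + r))) +
        (6 * k (p + (-q - s)) + 6 * k (p + (-q + s))) := by
    have h := BT_le hT μ (p, a) (q, b)
    have h1 := one_div_add_abs_sq_sub_le hα hαβ.le hαβT hrβ (p + q)
    have h2 := one_div_add_abs_sq_sub_le hα hαβ.le hαβT hsβ (p - q)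
    rw [hr2] at h1
    rw [hs2] at h2
    simp only at h
    rw [show (p + q) ^ 2 + (a + b) ^ 2 - μ = (p + q) ^ 2 - (μ - (a + b) ^ 2) by ring,
      show (p - q) ^ 2 + (a - b) ^ 2 - μ = (p - q) ^ 2 - (μ - (a - b) ^ 2) by ring,
      ← mul_one_div 3, ← mul_one_div 3 (2 * T + |(p - q) ^ 2 - (μ - (a - b) ^ 2)|)] at h
    simp only [hk]
    rw [show p + (q - r) = p + q - r by ring, show p + (q + r) = p + q + r by ring,
      show p + (-q - s) = p - q - s by ring, show p + (-q + s) = p - q + s by ring]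
    linarith
  calc ∫ p : ℝ, BT T μ (p, a) (q, b)
      ≤ ∫ p, ((6 * k (p + (q - r)) + 6 * k (p + (q + r))) +
          (6 * k (p + (-q - s)) + 6 * k (p + (-q + s)))) :=
        integral_mono_of_nonneg (ae_of_all _ fun p => BT_nonneg hT μ _ _)
          ((hpair _ _).add (hpair _ _)) (ae_of_all _ hbound)
    _ = 48 * (Real.log (β / α) / (β - α)) := by
        rw [integral_add (hpair _ _) (hpair _ _),
          integral_add (hshift _) (hshift _), integral_add (hshift _) (hshift _)]
        simp only [hshiftI]
        ring

/-- If `ξ(T), ξ'(T) → 0` as `T → 0⁺`, then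
`sup_{q₁} ∫_ℝ B_T((p₁,ξ(T)),(q₁,ξ'(T))) dp₁ = O(log(μ/T))` as `T → 0`. -/
theorem BT_line_integral_bound (μ : ℝ) (hμ : 0 < μ) (ξ ξ' : ℝ → ℝ)
    (hξ : Tendsto ξ (nhdsWithin 0 (Set.Ioi 0)) (nhds 0))
    (hξ' : Tendsto ξ' (nhdsWithin 0 (Set.Ioi 0)) (nhds 0)) :
    ∃ C > (0 : ℝ), ∃ T₀ : ℝ, 0 < T₀ ∧ T₀ < μ ∧ ∀ T, 0 < T → T < T₀ → ∀ q₁ : ℝ,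
      (∫ p₁ : ℝ, BT T μ (p₁, ξ T) (q₁, ξ' T)) ≤ C * Real.log (μ / T) := by
  set β := √(μ / 8) with hβ
  have hβpos : 0 < β := Real.sqrt_pos.2 (by positivity)
  have hβ2 : β ^ 2 = μ / 8 := Real.sq_sqrt (by positivity)
  have hsmall : ∀ᶠ T in nhdsWithin 0 (Set.Ioi 0), |ξ T| < β ∧ |ξ' T| < β := by
    have h1 := hξ.abs.eventually_lt_const (by simpa using hβpos)
    have h2 := hξ'.abs.eventually_lt_const (by simpa using hβpos)
    exact h1.and h2
  obtain ⟨δ, hδ, hδsmall⟩ := mem_nhdsGT_iff_exists_Ioo_subset.1 hsmall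
  have hδ0 : 0 < δ := hδ
  refine ⟨96 / β, by positivity, min δ (μ / 64), by positivity,
    (min_le_right _ _).trans_lt (by linarith), fun T hT hTlt q₁ => ?_⟩
  have hTδ : T < δ := hTlt.trans_le (min_le_left _ _)
  have hTμ : T < μ / 64 := hTlt.trans_le (min_le_right _ _)
  obtain ⟨ha, hb⟩ := hδsmall ⟨hT, hTδ⟩
  set α := 4 * T / β with hα
  have hαpos : 0 < α := by positivity
  have hαβ : α * β = 4 * T := div_mul_cancel₀ _ hβpos.ne'
  have hα2 : α ≤ β / 2 := by
    rw [hα, div_le_iff₀ hβpos]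
    nlinarith
  have ha2 := sq_lt_sq' (abs_lt.1 ha).1 (abs_lt.1 ha).2
  have hb2 := sq_lt_sq' (abs_lt.1 hb).1 (abs_lt.1 hb).2
  refine (integral_BT_le hT hαpos (by linarith) hαβ.le
    (by nlinarith [sq_nonneg (ξ T - ξ' T)]) (by nlinarith [sq_nonneg (ξ T + ξ' T)]) q₁).trans ?_
  have hratio : β / α ≤ μ / T := by
    have : β / α = μ / T / 32 := by
      rw [hα, div_div_eq_mul_div, ← sq, hβ2]
      field_simp
      norm_num
    have : 0 < μ / T := by positivity
    linarith
  have hlog : Real.log (β / α) ≤ Real.log (μ / T) := Real.log_le_log (by positivity) hratio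
  have hlog0 : 0 ≤ Real.log (μ / T) := Real.log_nonneg ((one_le_div hT).2 (by linarith))
  calc 48 * (Real.log (β / α) / (β - α)) ≤ 48 * (Real.log (μ / T) / (β / 2)) := by
        gcongr
        linarith
    _ = 96 / β * Real.log (μ / T) := by
        field_simp
        ring
end
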